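/- Let 𝔠 = {C_1,…,C_M} (M ≥ 2) be pairwise-distinct binary linear codes of length n with minimum cross-code distance δ. Let i ∈ [M], let T ∈ F_2^{N×n} have all rows in C_i, let E ∈ F_2^{N×n}, set Y = T + E, and let N* ≤ N. Suppose there exists a subset R ⊆ [N] with |R| = N* such that rank(T[R,:]) = dim(C_i) and every row of E indexed by R has Hamming weight at most ⌊(δ−1)/2⌋. Then D_i(Y)[R,:] = T[R,:] and d_s(⟨D_i(Y)[R,:]⟩, C_i) = 0; consequently, min over all subsets R' ⊆ [N] with |R'| = N* of d_s(⟨D_i(Y)[R',:]⟩, C_i) equals 0. -/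

import Mathlib

open Submodule Module

/-- The subspace distance between two subspaces. -/
noncomputable def sdist {F V : Type*} [Field F] [AddCommGroup V] [Module F V]
    (U W : Submodule F V) : ℕ :=
  finrank F ↥(U ⊔ W) - finrank F ↥(U ⊓ W)

/-- The row space of a matrix. -/
def rowSpace {F : Type*} [Field F] {m n : Type*} (A : Matrix m n F) :
    Submodule F (n → F) :=
  Submodule.span F (Set.range fun r => A r)

/-- The minimum cross-code distance `δ` of a family of codes: the minimum Hamming distance
between any pair of distinct codewords taken from any two distinct codes of the family. -/
noncomputable def crossDist {M n : ℕ}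
    (C : Fin M → Submodule (ZMod 2) (Fin n → ZMod 2)) : ℕ :=
  sInf {d | ∃ i j, i ≠ j ∧ ∃ c ∈ C i, ∃ c' ∈ C j, c ≠ c' ∧ d = hammingDist c c'}

open Classical in
/-- The denoised vector of `y` with respect to a code `Cj` (relative to a distance
parameter `δ`): a codeword `c ∈ Cj` with `d_H(c,y) < δ/2` if one exists, else `y` itself. -/
noncomputable def denoise {n : ℕ} (δ : ℕ) (Cj : Submodule (ZMod 2) (Fin n → ZMod 2))
    (y : Fin n → ZMod 2) : Fin n → ZMod 2 :=
  if h : ∃ c ∈ Cj, 2 * hammingDist c y < δ then h.choose else y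

/-- The denoised matrix `D_j(Y)`: the matrix obtained from `Y` by denoising each row
with respect to the code `Cj`. -/
noncomputable def denoiseMatrix {N n : ℕ} (δ : ℕ)
    (Cj : Submodule (ZMod 2) (Fin n → ZMod 2)) (Y : Matrix (Fin N) (Fin n) (ZMod 2)) :
    Matrix (Fin N) (Fin n) (ZMod 2) :=
  Matrix.of fun r => denoise δ Cj (Y r)

/-- The denoised subspace discrepancy `Δ_SD(Y, Cj) = d_s(⟨D_j(Y)⟩, Cj)`. -/
noncomputable def discSD {N n : ℕ} (δ : ℕ)
    (Cj : Submodule (ZMod 2) (Fin n → ZMod 2)) (Y : Matrix (Fin N) (Fin n) (ZMod 2)) : ℕ :=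
  sdist (rowSpace (denoiseMatrix δ Cj Y)) Cj

theorem sdist_self {F V : Type*} [Field F] [AddCommGroup V] [Module F V]
    (U : Submodule F V) : sdist U U = 0 := by
  unfold sdist
  rw [sup_idem, inf_idem, Nat.sub_self]

/-- If the rows of `A` lie in `U` and `A` has rank `dim U`, then its row space is `U`. -/
theorem rowSpace_eq_of_rank_eq_finrank {F : Type*} [Field F] {m n : Type*} [Finite m] [Fintype n]
    (A : Matrix m n F) (U : Submodule F (n → F)) (hA : ∀ r, A r ∈ U)
    (hrank : A.rank = finrank F ↥U) : rowSpace A = U := by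
  refine Submodule.eq_of_le_of_finrank_eq ?_ ?_
  · exact Submodule.span_le.2 (Set.range_subset_iff.2 hA)
  · exact A.rank_eq_finrank_span_row.symm.trans hrank

/-- The cross-code distance of a family with two distinct codes is positive. -/
theorem crossDist_pos {M n : ℕ} (hM : 2 ≤ M)
    (C : Fin M → Submodule (ZMod 2) (Fin n → ZMod 2)) (hC : Function.Injective C) :
    0 < crossDist C := by
  have : Nontrivial (Fin M) := Fin.nontrivial_iff_two_le.2 hM
  obtain ⟨i, j, hij⟩ := exists_pair_ne (Fin M)
  have hne : {d | ∃ i j, i ≠ j ∧ ∃ c ∈ C i, ∃ c' ∈ C j,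
      c ≠ c' ∧ d = hammingDist c c'}.Nonempty := by
    by_cases hi : C i = ⊥
    · have hj : C j ≠ ⊥ := fun h => hij (hC (hi.trans h.symm))
      obtain ⟨c, hc, hc0⟩ := Submodule.exists_mem_ne_zero_of_ne_bot hj
      exact ⟨_, j, i, hij.symm, c, hc, 0, zero_mem _, hc0, rfl⟩
    · obtain ⟨c, hc, hc0⟩ := Submodule.exists_mem_ne_zero_of_ne_bot hi
      exact ⟨_, i, j, hij, c, hc, 0, zero_mem _, hc0, rfl⟩
  obtain ⟨_, _, _, c, _, c', _, hcc, hd⟩ := Nat.sInf_mem hne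
  exact (hammingDist_pos.2 hcc).trans_eq hd.symm

/-- Since every code contains `0`, the cross-code distance also bounds from below the minimum
distance of each single code. -/
theorem crossDist_le_hammingDist {M n : ℕ} (hM : 2 ≤ M)
    (C : Fin M → Submodule (ZMod 2) (Fin n → ZMod 2)) (i : Fin M) {c c' : Fin n → ZMod 2}
    (hc : c ∈ C i) (hc' : c' ∈ C i) (hne : c ≠ c') : crossDist C ≤ hammingDist c c' := by
  have : Nontrivial (Fin M) := Fin.nontrivial_iff_two_le.2 hM
  obtain ⟨j, hj⟩ := exists_ne i
  refine Nat.sInf_le ⟨i, j, hj.symm, c - c', sub_mem hc hc', 0, zero_mem _,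
    sub_ne_zero.2 hne, ?_⟩
  rw [hammingDist_zero_right, hammingDist_comm, hammingDist_eq_hammingNorm, neg_add_eq_sub]

/-- Unique decoding: when distinct codewords are at distance at least `δ`, denoising recovers a
codeword at distance less than `δ / 2`. -/
theorem denoise_eq_of_two_mul_hammingDist_lt {n δ : ℕ}
    {U : Submodule (ZMod 2) (Fin n → ZMod 2)}
    (hU : ∀ c ∈ U, ∀ c' ∈ U, c ≠ c' → δ ≤ hammingDist c c') {c y : Fin n → ZMod 2}
    (hc : c ∈ U) (hy : 2 * hammingDist c y < δ) : denoise δ U y = c := by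
  have h : ∃ c ∈ U, 2 * hammingDist c y < δ := ⟨c, hc, hy⟩
  rw [denoise, dif_pos h]
  obtain ⟨hmem, hlt⟩ := h.choose_spec
  by_contra hne
  have hle := hU _ hmem _ hc hne
  have htri := hammingDist_triangle_right h.choose c y
  omega

/-- **Guarantee for the Improved M-DenSD decoder.** If there is a subset `R ⊆ [N]` of size
`N*` such that the submatrix `T[R,:]` has rank `dim C_i` and every row of `E` indexed by `R`
has Hamming weight at most `⌊(δ−1)/2⌋`, then `D_i(Y)[R,:] = T[R,:]` and
`d_s(⟨D_i(Y)[R,:]⟩, C_i) = 0`; consequently the minimum of `d_s(⟨D_i(Y)[R',:]⟩, C_i)` over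
all subsets `R' ⊆ [N]` of size `N*` equals `0`. -/
theorem improved_mDenSD_guarantee {M n N Nstar : ℕ} (hM : 2 ≤ M)
    (C : Fin M → Submodule (ZMod 2) (Fin n → ZMod 2)) (hC : Function.Injective C)
    (i : Fin M) (T E Y : Matrix (Fin N) (Fin n) (ZMod 2))
    (hT : ∀ r, T r ∈ C i)
    (hY : Y = T + E)
    (hNstar : Nstar ≤ N)
    (R : Finset (Fin N)) (hRcard : R.card = Nstar)
    (hRrank : (Matrix.of fun r : {x // x ∈ R} => T r.1).rank = finrank (ZMod 2) ↥(C i))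
    (hRE : ∀ r ∈ R, hammingNorm (E r) ≤ (crossDist C - 1) / 2) :
    (∀ r ∈ R, denoiseMatrix (crossDist C) (C i) Y r = T r) ∧
    sdist (rowSpace (Matrix.of fun r : {x // x ∈ R} =>
      denoiseMatrix (crossDist C) (C i) Y r.1)) (C i) = 0 ∧
    sInf {d | ∃ R' : Finset (Fin N), R'.card = Nstar ∧
      d = sdist (rowSpace (Matrix.of fun r : {x // x ∈ R'} =>
        denoiseMatrix (crossDist C) (C i) Y r.1)) (C i)} = 0 := by
  have hrow : ∀ r ∈ R, denoiseMatrix (crossDist C) (C i) Y r = T r := by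
    intro r hr
    refine denoise_eq_of_two_mul_hammingDist_lt
      (fun c hc c' hc' => crossDist_le_hammingDist hM C i hc hc') (hT r) ?_
    have hpos := crossDist_pos hM C hC
    have hE := hRE r hr
    have hd : hammingDist (T r) (Y r) = hammingNorm (E r) := by
      rw [hammingDist_eq_hammingNorm, hY]
      exact congrArg hammingNorm (neg_add_cancel_left (T r) (E r))
    omega
  have hzero : sdist (rowSpace (Matrix.of fun r : {x // x ∈ R} =>
      denoiseMatrix (crossDist C) (C i) Y r.1)) (C i) = 0 := by
    have hsub : (Matrix.of fun r : {x // x ∈ R} => denoiseMatrix (crossDist C) (C i) Y r.1) =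
        Matrix.of fun r : {x // x ∈ R} => T r.1 :=
      congrArg Matrix.of (funext fun r => hrow r.1 r.2)
    have hspace := rowSpace_eq_of_rank_eq_finrank
      (Matrix.of fun r : {x // x ∈ R} => T r.1) (C i) (fun r => hT r.1) hRrank
    rw [hsub, hspace, sdist_self]
  exact ⟨hrow, hzero, Nat.sInf_eq_zero.2 (Or.inl ⟨R, hRcard, hzero.symm⟩)⟩
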